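/- arXiv:2006.12039 — 4 statements merged into one kernel-verified Lean document; each statement's English description precedes it below -/
import Mathlib

section
/- Let p, r, n be positive integers, let L be a p×r real matrix with L^⊤L = p·I_r, let Γ^s be a p×p real matrix, and let Ψ₁, …, Ψ_n be r×r real matrices. Define Γ_k = L Ψ_k L^⊤ + Γ^s for k = 1, …, n, and set Γ̄ = (1/n) Σ_{k=1}^n Γ_k, Ψ̄ = (1/n) Σ_{k=1}^n Ψ_k, and S_n = (1/(pn)) Σ_{k=1}^n (Γ_k − Γ̄)². Then S_n = L ((1/n) Σ_{k=1}^n (Ψ_k − Ψ̄)²) L^⊤, and moreover p^{-2} L^⊤ S_n L = (1/n) Σ_{k=1}^n Ψ_k² − ((1/n) Σ_{k=1}^n Ψ_k)². In particular S_n has rank at most r and is free of the idiosyncratic volatility matrix Γ^s. -/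
open Matrix

/-- The square of a conjugate by a matrix whose columns are orthogonal of squared norm `c`. -/
lemma conj_transpose_sq {m k : Type*} [Fintype m] [DecidableEq m] [Fintype k] [DecidableEq k]
    {c : ℝ} {L : Matrix m k ℝ} (hL : Lᵀ * L = c • (1 : Matrix k k ℝ)) (A : Matrix k k ℝ) :
    (L * A * Lᵀ) ^ 2 = c • (L * A ^ 2 * Lᵀ) := by
  calc (L * A * Lᵀ) ^ 2 = L * A * (Lᵀ * L) * A * Lᵀ := by simp only [sq, Matrix.mul_assoc]
    _ = c • (L * A ^ 2 * Lᵀ) := by simp [hL, sq, Matrix.mul_assoc]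

/-- The mean of the squared deviations is the mean of the squares minus the square of the mean. -/
lemma mean_sq_sub_mean {R : Type*} [Ring R] [Algebra ℝ R] {n : ℕ} (hn : n ≠ 0) (x : Fin n → R) :
    (n : ℝ)⁻¹ • ∑ k, (x k - (n : ℝ)⁻¹ • ∑ l, x l) ^ 2
      = (n : ℝ)⁻¹ • ∑ k, x k ^ 2 - ((n : ℝ)⁻¹ • ∑ k, x k) ^ 2 := by
  have hn' : (n : ℝ) ≠ 0 := Nat.cast_ne_zero.mpr hn
  set a := (n : ℝ)⁻¹ • ∑ l, x l with ha
  have hsum : ∑ l, x l = (n : ℝ) • a := by rw [ha, smul_inv_smul₀ hn']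
  have hsq : ∀ k, (x k - a) ^ 2 = x k ^ 2 - x k * a - a * x k + a ^ 2 := fun k => by
    noncomm_ring
  have hconst : ∑ _k : Fin n, a ^ 2 = (n : ℝ) • a ^ 2 := by
    simp [Nat.cast_smul_eq_nsmul]
  have htotal : ∑ k, (x k - a) ^ 2 = ∑ k, x k ^ 2 - (n : ℝ) • a ^ 2 := by
    simp only [hsq, Finset.sum_add_distrib, Finset.sum_sub_distrib, ← Finset.sum_mul,
      ← Finset.mul_sum, hsum, hconst, smul_mul_assoc, mul_smul_comm, ← sq]
    abel
  rw [htotal, smul_sub, inv_smul_smul₀ hn']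

/-- With Γ_k = LΨ_kLᵀ + Γ^s and LᵀL = p·I_r, the scaled sample variance
S_n = (1/(pn)) Σ_k (Γ_k − Γ̄)² equals L((1/n)Σ_k(Ψ_k − Ψ̄)²)Lᵀ, is free of Γ^s,
has rank at most r, and satisfies p⁻²LᵀS_nL = (1/n)Σ_kΨ_k² − ((1/n)Σ_kΨ_k)². -/
theorem stmt_7 (p r n : ℕ) (hp : 0 < p) (hr : 0 < r) (hn : 0 < n)
    (L : Matrix (Fin p) (Fin r) ℝ)
    (hL : Lᵀ * L = (p : ℝ) • (1 : Matrix (Fin r) (Fin r) ℝ))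
    (Γs : Matrix (Fin p) (Fin p) ℝ)
    (Ψ : Fin n → Matrix (Fin r) (Fin r) ℝ)
    (Γ : Fin n → Matrix (Fin p) (Fin p) ℝ)
    (hΓ : ∀ k, Γ k = L * Ψ k * Lᵀ + Γs) :
    (((p : ℝ) * (n : ℝ))⁻¹ • ∑ k, (Γ k - (n : ℝ)⁻¹ • ∑ l, Γ l) ^ 2
        = L * ((n : ℝ)⁻¹ • ∑ k, (Ψ k - (n : ℝ)⁻¹ • ∑ l, Ψ l) ^ 2) * Lᵀ)
    ∧ (((p : ℝ) ^ 2)⁻¹ •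
          (Lᵀ * (((p : ℝ) * (n : ℝ))⁻¹ • ∑ k, (Γ k - (n : ℝ)⁻¹ • ∑ l, Γ l) ^ 2) * L)
        = (n : ℝ)⁻¹ • ∑ k, Ψ k ^ 2 - ((n : ℝ)⁻¹ • ∑ k, Ψ k) ^ 2)
    ∧ (((p : ℝ) * (n : ℝ))⁻¹ • ∑ k, (Γ k - (n : ℝ)⁻¹ • ∑ l, Γ l) ^ 2).rank ≤ r := by
  have hp' : (p : ℝ) ≠ 0 := Nat.cast_ne_zero.mpr hp.ne'
  have hn' : (n : ℝ) ≠ 0 := Nat.cast_ne_zero.mpr hn.ne'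
  have hdev : ∀ k, Γ k - (n : ℝ)⁻¹ • ∑ l, Γ l
      = L * (Ψ k - (n : ℝ)⁻¹ • ∑ l, Ψ l) * Lᵀ := fun k => by
    have hconst : (n : ℝ)⁻¹ • ∑ _l : Fin n, Γs = Γs := by
      rw [Finset.sum_const, Finset.card_univ, Fintype.card_fin, ← Nat.cast_smul_eq_nsmul ℝ,
        inv_smul_smul₀ hn']
    simp only [hΓ, Finset.sum_add_distrib, smul_add, hconst, ← Matrix.sum_mul,
      ← Matrix.mul_sum, Matrix.mul_sub, Matrix.sub_mul, Matrix.mul_smul, Matrix.smul_mul]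
    abel
  have hS : ((p : ℝ) * (n : ℝ))⁻¹ • ∑ k, (Γ k - (n : ℝ)⁻¹ • ∑ l, Γ l) ^ 2
      = L * ((n : ℝ)⁻¹ • ∑ k, (Ψ k - (n : ℝ)⁻¹ • ∑ l, Ψ l) ^ 2) * Lᵀ := by
    simp only [hdev, conj_transpose_sq hL]
    rw [← Finset.smul_sum, smul_smul, _root_.mul_inv_rev, inv_mul_cancel_right₀ hp',
      ← Matrix.sum_mul, ← Matrix.mul_sum, Matrix.mul_smul, Matrix.smul_mul]
  refine ⟨hS, ?_, ?_⟩
  · rw [hS, mean_sq_sub_mean hn.ne']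
    set V := (n : ℝ)⁻¹ • ∑ k, Ψ k ^ 2 - ((n : ℝ)⁻¹ • ∑ k, Ψ k) ^ 2
    have hV : Lᵀ * (L * V * Lᵀ) * L = (p : ℝ) ^ 2 • V := by
      calc Lᵀ * (L * V * Lᵀ) * L = (Lᵀ * L) * V * (Lᵀ * L) := by simp only [Matrix.mul_assoc]
        _ = (p : ℝ) ^ 2 • V := by simp [hL, smul_smul, sq]
    rw [hV, inv_smul_smul₀ (pow_ne_zero 2 hp')]
  · rw [hS, Matrix.mul_assoc]
    exact (Matrix.rank_mul_le_left _ _).trans (Matrix.rank_le_width L)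
end

section
/- (Davis–Kahan sin-theta bound for eigenvectors.) Let A and Â be p×p real symmetric matrices and let λ₁(M) ≥ … ≥ λ_p(M) denote the eigenvalues of a real symmetric matrix M in decreasing order, with the conventions λ₀(A) = +∞ and λ_{p+1}(A) = −∞. Fix i ∈ {1, …, p} and suppose the eigengap δ = min(λ_{i−1}(A) − λ_i(A), λ_i(A) − λ_{i+1}(A)) is positive. Let v be a unit-norm eigenvector of A with eigenvalue λ_i(A) and let v̂ be a unit-norm eigenvector of Â with eigenvalue λ_i(Â). Then there exists a sign s ∈ {−1, +1} such that ‖v̂ − s·v‖₂ ≤ 2^{3/2} ‖Â − A‖₂ / δ. (This eigenvector perturbation bound underlies the factor loading estimation error in Theorem 1.) -/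
open Matrix

/-- The spectral norm (ℓ²→ℓ² operator norm) of a real matrix. -/
noncomputable def specNorm {m n : Type*} [Fintype m] [Fintype n] [DecidableEq n]
    (A : Matrix m n ℝ) : ℝ :=
  ‖LinearMap.toContinuousLinearMap (Matrix.toEuclideanLin A)‖

open scoped InnerProductSpace

section Spectral

variable {ι F : Type*} [Fintype ι] [NormedAddCommGroup F] [InnerProductSpace ℝ F]

/-- Coordinates of `T x` in an orthonormal eigenbasis of `T`. -/
lemma inner_apply_of_eigenbasis (b : OrthonormalBasis ι ℝ F) (T : F →ₗ[ℝ] F) (a : ι → ℝ)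
    (hT : ∀ j, T (b j) = a j • b j) (j : ι) (x : F) :
    ⟪b j, T x⟫_ℝ = a j * ⟪b j, x⟫_ℝ := by
  classical
  conv_lhs => rw [← b.sum_repr' x]
  simp [hT, inner_sum, inner_smul_right, b.inner_eq_ite, mul_comm]

/-- The quadratic form of `T` in an orthonormal eigenbasis. -/
lemma inner_apply_self_of_eigenbasis (b : OrthonormalBasis ι ℝ F) (T : F →ₗ[ℝ] F) (a : ι → ℝ)
    (hT : ∀ j, T (b j) = a j • b j) (x : F) :
    ⟪x, T x⟫_ℝ = ∑ j, a j * ⟪b j, x⟫_ℝ ^ 2 := by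
  rw [← b.sum_inner_mul_inner x (T x)]
  refine Finset.sum_congr rfl fun j _ ↦ ?_
  rw [inner_apply_of_eigenbasis b T a hT, real_inner_comm]
  ring

lemma norm_sq_eq_sum_inner_sq (b : OrthonormalBasis ι ℝ F) (x : F) :
    ‖x‖ ^ 2 = ∑ j, ⟪b j, x⟫_ℝ ^ 2 := by
  simp [← b.sum_sq_norm_inner_right x]

/-- One-sided Weyl inequality: a bound on the quadratic form of `T - S` bounds the difference of
the `i`-th largest eigenvalues of `T` and `S`. -/
lemma eigenvalue_sub_le_of_inner_le {p : ℕ} (b b' : OrthonormalBasis (Fin p) ℝ F)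
    (T S : F →ₗ[ℝ] F) (a a' : Fin p → ℝ) (ha : Antitone a) (ha' : Antitone a')
    (hT : ∀ j, T (b j) = a j • b j) (hS : ∀ j, S (b' j) = a' j • b' j) (e : ℝ)
    (he : ∀ x, ⟪x, T x - S x⟫_ℝ ≤ e * ‖x‖ ^ 2) (i : Fin p) :
    a i - a' i ≤ e := by
  have : FiniteDimensional ℝ F := b.toBasis.finiteDimensional_of_finite
  let L : F →ₗ[ℝ] ({j : Fin p // j ≠ i} → ℝ) :=
    LinearMap.pi fun j ↦ if i < j.1 then (innerₛₗ ℝ (b j.1)) else innerₛₗ ℝ (b' j.1)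
  have hL : LinearMap.ker L ≠ ⊥ := by
    apply LinearMap.ker_ne_bot_of_finrank_lt
    have hp : 0 < p := i.pos
    simp [Module.finrank_eq_card_basis b.toBasis, Fintype.card_subtype_compl, hp]
  obtain ⟨x, hx, hx0⟩ := (Submodule.ne_bot_iff _).1 hL
  have hx' (j : Fin p) (hj : j ≠ i) : L x ⟨j, hj⟩ = 0 := by
    rw [LinearMap.mem_ker.1 hx]; rfl
  have h₁ (j : Fin p) (hj : i < j) : ⟪b j, x⟫_ℝ = 0 := by
    simpa [L, hj] using hx' j hj.ne'
  have h₂ (j : Fin p) (hj : j < i) : ⟪b' j, x⟫_ℝ = 0 := by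
    simpa [L, hj.not_gt] using hx' j hj.ne
  have hTx : a i * ‖x‖ ^ 2 ≤ ⟪x, T x⟫_ℝ := by
    rw [inner_apply_self_of_eigenbasis b T a hT, norm_sq_eq_sum_inner_sq b, Finset.mul_sum]
    refine Finset.sum_le_sum fun j _ ↦ ?_
    rcases le_or_gt j i with h | h
    · exact mul_le_mul_of_nonneg_right (ha h) (sq_nonneg _)
    · simp [h₁ j h]
  have hSx : ⟪x, S x⟫_ℝ ≤ a' i * ‖x‖ ^ 2 := by
    rw [inner_apply_self_of_eigenbasis b' S a' hS, norm_sq_eq_sum_inner_sq b', Finset.mul_sum]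
    refine Finset.sum_le_sum fun j _ ↦ ?_
    rcases le_or_gt i j with h | h
    · exact mul_le_mul_of_nonneg_right (ha' h) (sq_nonneg _)
    · simp [h₂ j h]
  have hpos : 0 < ‖x‖ ^ 2 := by have := norm_pos_iff.2 hx0; positivity
  have hex := he x
  rw [inner_sub_right] at hex
  exact le_of_mul_le_mul_right (by linarith) hpos

/-- If all other eigenvalues are at distance at least `δ` from `a i`, then `T - a i` is bounded
below by `δ` on the orthogonal complement of the `i`-th eigenvector. -/
lemma mul_norm_le_of_eigenvalue_gap (b : OrthonormalBasis ι ℝ F) (T : F →ₗ[ℝ] F) (a : ι → ℝ)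
    (hT : ∀ j, T (b j) = a j • b j) (i : ι) (δ : ℝ) (hδ : 0 ≤ δ)
    (hgap : ∀ j, j ≠ i → δ ≤ |a j - a i|) (x : F) (hx : ⟪b i, x⟫_ℝ = 0) :
    δ * ‖x‖ ≤ ‖T x - a i • x‖ := by
  refine (sq_le_sq₀ (by positivity) (norm_nonneg _)).1 ?_
  rw [mul_pow, norm_sq_eq_sum_inner_sq b, norm_sq_eq_sum_inner_sq b, Finset.mul_sum]
  refine Finset.sum_le_sum fun j _ ↦ ?_
  rw [inner_sub_right, inner_apply_of_eigenbasis b T a hT, inner_smul_right, ← sub_mul, mul_pow]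
  by_cases hj : j = i
  · simp [hj, hx]
  · refine mul_le_mul_of_nonneg_right ?_ (sq_nonneg _)
    rw [← sq_abs (a j - a i)]
    exact pow_le_pow_left₀ hδ (hgap j hj) 2

/-- A vector orthogonal to an eigenvector for a simple eigenvalue `a i` is orthogonal to the `i`-th
element of any orthonormal eigenbasis. -/
lemma inner_eigenbasis_eq_zero (b : OrthonormalBasis ι ℝ F) (T : F →ₗ[ℝ] F) (a : ι → ℝ)
    (hT : ∀ j, T (b j) = a j • b j) (i : ι) (hsimple : ∀ j, j ≠ i → a j ≠ a i)
    (v x : F) (hv : v ≠ 0) (hTv : T v = a i • v) (hx : ⟪v, x⟫_ℝ = 0) :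
    ⟪b i, x⟫_ℝ = 0 := by
  have hj (j : ι) (hj : j ≠ i) : ⟪b j, v⟫_ℝ = 0 := by
    have h := inner_apply_of_eigenbasis b T a hT j v
    rw [hTv, inner_smul_right] at h
    exact (mul_eq_mul_right_iff.1 h).resolve_left (hsimple j hj).symm
  have hvi : v = ⟪b i, v⟫_ℝ • b i := by
    conv_lhs => rw [← b.sum_repr' v]
    exact Finset.sum_eq_single i (fun j _ h ↦ by simp [hj j h]) (by simp)
  rw [hvi, inner_smul_left] at hx
  refine (mul_eq_zero.1 hx).resolve_left fun h ↦ hv ?_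
  rw [hvi, show ⟪b i, v⟫_ℝ = 0 by simpa using h, zero_smul]

/-- For unit vectors, the distance up to sign is at most `√2` times the sine of the angle. -/
lemma exists_sign_norm_sub_smul_le (v w : F) (hv : ‖v‖ = 1) (hw : ‖w‖ = 1) :
    ∃ s : ℝ, (s = 1 ∨ s = -1) ∧ ‖w - s • v‖ ≤ √2 * ‖w - ⟪v, w⟫_ℝ • v‖ := by
  have hc : |⟪v, w⟫_ℝ| ≤ 1 := by simpa [hv, hw] using abs_real_inner_le_norm v w
  have key (s : ℝ) : ‖w - s • v‖ ^ 2 = 1 - 2 * s * ⟪v, w⟫_ℝ + s ^ 2 := by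
    rw [norm_sub_sq_real, inner_smul_right, norm_smul, hv, hw, real_inner_comm, mul_one,
      Real.norm_eq_abs, sq_abs]
    ring
  obtain ⟨hc₁, hc₂⟩ := abs_le.1 hc
  have bound (s : ℝ) (hs : ‖w - s • v‖ ^ 2 ≤ 2 * (1 - ⟪v, w⟫_ℝ ^ 2)) :
      ‖w - s • v‖ ≤ √2 * ‖w - ⟪v, w⟫_ℝ • v‖ := by
    refine (sq_le_sq₀ (norm_nonneg _) (by positivity)).1 ?_
    rw [mul_pow, Real.sq_sqrt zero_le_two, key ⟪v, w⟫_ℝ]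
    linarith
  rcases le_total 0 ⟪v, w⟫_ℝ with h | h
  · refine ⟨1, Or.inl rfl, bound 1 ?_⟩
    rw [key]; nlinarith
  · refine ⟨-1, Or.inr rfl, bound (-1) ?_⟩
    rw [key]; nlinarith

end Spectral

/-- A Hermitian matrix has an orthonormal eigenbasis realizing any reordering of its eigenvalues. -/
lemma exists_eigenbasis_of_perm {n : Type*} [Fintype n] [DecidableEq n] {A : Matrix n n ℝ}
    (hA : A.IsHermitian) (a : n → ℝ) (ha : ∃ σ : Equiv.Perm n, a = hA.eigenvalues ∘ σ) :
    ∃ b : OrthonormalBasis n ℝ (EuclideanSpace ℝ n),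
      ∀ j, Matrix.toEuclideanLin A (b j) = a j • b j := by
  obtain ⟨σ, rfl⟩ := ha
  refine ⟨hA.eigenvectorBasis.reindex σ.symm, fun j ↦ ?_⟩
  ext k
  simpa using congrFun (hA.mulVec_eigenvectorBasis (σ j)) k

lemma norm_toEuclideanLin_le_specNorm {m n : Type*} [Fintype m] [Fintype n] [DecidableEq n]
    (A : Matrix m n ℝ) (x : EuclideanSpace ℝ n) :
    ‖Matrix.toEuclideanLin A x‖ ≤ specNorm A * ‖x‖ :=
  (LinearMap.toContinuousLinearMap (Matrix.toEuclideanLin A)).le_opNorm x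

lemma inner_toEuclideanLin_le_specNorm {n : Type*} [Fintype n] [DecidableEq n]
    (A : Matrix n n ℝ) (x : EuclideanSpace ℝ n) :
    |⟪x, Matrix.toEuclideanLin A x⟫_ℝ| ≤ specNorm A * ‖x‖ ^ 2 := by
  refine (abs_real_inner_le_norm _ _).trans ?_
  nlinarith [norm_toEuclideanLin_le_specNorm A x, norm_nonneg x]

/-- **Weyl's inequality** for the ordered eigenvalues of real symmetric matrices. -/
lemma abs_eigenvalue_sub_le_specNorm {p : ℕ} (A B : Matrix (Fin p) (Fin p) ℝ)
    (b b' : OrthonormalBasis (Fin p) ℝ (EuclideanSpace ℝ (Fin p)))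
    (a a' : Fin p → ℝ) (ha : Antitone a) (ha' : Antitone a')
    (hA : ∀ j, Matrix.toEuclideanLin A (b j) = a j • b j)
    (hB : ∀ j, Matrix.toEuclideanLin B (b' j) = a' j • b' j) (i : Fin p) :
    |a' i - a i| ≤ specNorm (B - A) := by
  have hsub (x : EuclideanSpace ℝ (Fin p)) := inner_toEuclideanLin_le_specNorm (B - A) x
  simp only [map_sub, LinearMap.sub_apply] at hsub
  refine abs_sub_le_iff.2 ⟨?_, ?_⟩
  · exact eigenvalue_sub_le_of_inner_le b' b _ _ a' a ha' ha hB hA _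
      (fun x ↦ (le_abs_self _).trans (hsub x)) i
  · refine eigenvalue_sub_le_of_inner_le b b' _ _ a a' ha ha' hA hB _ (fun x ↦ ?_) i
    rw [← neg_sub, inner_neg_right]
    exact (neg_le_abs _).trans (hsub x)

/-- For a decreasing sequence, gaps to the neighbours of `i` are gaps to all other indices. -/
lemma Antitone.le_abs_sub_of_adjacent {p : ℕ} {a : Fin p → ℝ} (ha : Antitone a) (i : Fin p)
    (δ : ℝ) (hleft : ∀ j : Fin p, (j : ℕ) + 1 = (i : ℕ) → δ ≤ a j - a i)
    (hright : ∀ j : Fin p, (i : ℕ) + 1 = (j : ℕ) → δ ≤ a i - a j) (j : Fin p) (hj : j ≠ i) :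
    δ ≤ |a j - a i| := by
  rcases lt_or_gt_of_ne hj with h | h
  · have h' : (j : ℕ) < i := h
    let k : Fin p := ⟨i - 1, by omega⟩
    have hk := hleft k (by simp only [k]; omega)
    have hjk : a k ≤ a j := ha (Fin.le_def.2 (by simp only [k]; omega))
    exact le_trans (by linarith) (le_abs_self _)
  · have h' : (i : ℕ) < j := h
    let k : Fin p := ⟨i + 1, by omega⟩
    have hk := hright k rfl
    have hjk : a j ≤ a k := ha (Fin.le_def.2 (by simp only [k]; omega))
    exact le_trans (by linarith) (neg_le_abs _)

/-- Davis–Kahan sin-theta bound for eigenvectors: if a (resp. â) enumerates the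
eigenvalues of the real symmetric matrix A (resp. Â) in decreasing order, δ > 0 is a
lower bound for the eigengap min(λ_{i−1}(A) − λ_i(A), λ_i(A) − λ_{i+1}(A)) (the
constraints at the boundary indices being vacuous, corresponding to the conventions
λ₀ = +∞ and λ_{p+1} = −∞), v is a unit eigenvector of A for λ_i(A) and v̂ a unit
eigenvector of Â for λ_i(Â), then ‖v̂ − s·v‖₂ ≤ 2^{3/2}‖Â − A‖₂/δ for some sign s. -/
theorem stmt_12 (p : ℕ) (A Ahat : Matrix (Fin p) (Fin p) ℝ)
    (hA : A.IsHermitian) (hAhat : Ahat.IsHermitian)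
    (a ahat : Fin p → ℝ) (ha : Antitone a) (hahat : Antitone ahat)
    (haeig : ∃ σ : Equiv.Perm (Fin p), a = hA.eigenvalues ∘ σ)
    (hahateig : ∃ σ : Equiv.Perm (Fin p), ahat = hAhat.eigenvalues ∘ σ)
    (i : Fin p) (δ : ℝ) (hδpos : 0 < δ)
    (hgapleft : ∀ j : Fin p, (j : ℕ) + 1 = (i : ℕ) → δ ≤ a j - a i)
    (hgapright : ∀ j : Fin p, (i : ℕ) + 1 = (j : ℕ) → δ ≤ a i - a j)
    (v vhat : EuclideanSpace ℝ (Fin p)) (hv : ‖v‖ = 1) (hvhat : ‖vhat‖ = 1)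
    (hveig : Matrix.toEuclideanLin A v = a i • v)
    (hvhateig : Matrix.toEuclideanLin Ahat vhat = ahat i • vhat) :
    ∃ s : ℝ, (s = 1 ∨ s = -1) ∧
      ‖vhat - s • v‖ ≤ (2 : ℝ) ^ ((3 : ℝ) / 2) * specNorm (Ahat - A) / δ := by
  obtain ⟨b, hb⟩ := exists_eigenbasis_of_perm hA a haeig
  obtain ⟨b', hb'⟩ := exists_eigenbasis_of_perm hAhat ahat hahateig
  have hgap := ha.le_abs_sub_of_adjacent i δ hgapleft hgapright
  obtain ⟨s, hs, hle⟩ := exists_sign_norm_sub_smul_le v vhat hv hvhat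
  refine ⟨s, hs, hle.trans ?_⟩
  set w := vhat - ⟪v, vhat⟫_ℝ • v with hw
  have hvw : ⟪v, w⟫_ℝ = 0 := by
    simp [hw, inner_sub_right, inner_smul_right, hv]
  have hsimple (j : Fin p) (hj : j ≠ i) : a j ≠ a i := by
    intro h
    have := hgap j hj
    rw [h, sub_self, abs_zero] at this
    linarith
  have hbw := inner_eigenbasis_eq_zero b _ a hb i hsimple v w
    (by rintro rfl; simp at hv) hveig hvw
  have hlow := mul_norm_le_of_eigenvalue_gap b _ a hb i δ hδpos.le hgap w hbw
  have hres : Matrix.toEuclideanLin A w - a i • w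
      = (ahat i - a i) • vhat - Matrix.toEuclideanLin (Ahat - A) vhat := by
    simp only [hw, map_sub, map_smul, LinearMap.sub_apply, hveig, hvhateig]
    module
  have hup : ‖Matrix.toEuclideanLin A w - a i • w‖ ≤ 2 * specNorm (Ahat - A) := by
    rw [hres]
    refine (norm_sub_le _ _).trans ?_
    have h₁ := abs_eigenvalue_sub_le_specNorm A Ahat b b' a ahat ha hahat hb hb' i
    have h₂ := norm_toEuclideanLin_le_specNorm (Ahat - A) vhat
    rw [hvhat, mul_one] at h₂
    rw [norm_smul, hvhat, mul_one, Real.norm_eq_abs]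
    linarith
  have hpow : (2 : ℝ) ^ ((3 : ℝ) / 2) = √2 * 2 := by
    rw [show (3 : ℝ) / 2 = 1 / 2 + 1 by norm_num, Real.rpow_add two_pos, Real.rpow_one,
      Real.sqrt_eq_rpow]
  rw [hpow, mul_assoc, mul_div_assoc]
  refine mul_le_mul_of_nonneg_left ?_ (Real.sqrt_nonneg 2)
  rw [le_div_iff₀ hδpos, mul_comm]
  exact hlow.trans hup
end

section
/- (Adaptive thresholding: spectral norm bound.) Fix δ ∈ [0,1) and constants 0 < c₁ ≤ c₂. There exists a constant C, depending only on δ, c₁, c₂, with the following property. Let Σ = (σ_ij) be a p×p real symmetric matrix with c₁ ≤ σ_ii ≤ c₂ for all i, satisfying the generalized sparsity condition max_{1≤j≤p} Σ_{i=1}^p |σ_ij|^δ (σ_ii σ_jj)^{(1−δ)/2} ≤ s_p for some s_p > 0. Let Σ̃ = (σ̃_ij) be a p×p real symmetric matrix with max_{i,j} |σ̃_ij − σ_ij| ≤ a, where a ≤ c₁/2. Let ϖ be a threshold level with 4a/c₁ ≤ ϖ ≤ 1, set adaptive thresholds ϖ_ij = ϖ · sqrt((σ̃_ii ∨ 0)(σ̃_jj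 ∨ 0)), and define the thresholded matrix Σ̂ = (σ̂_ij) by σ̂_ij = s_ij(σ̃_ij)·1(|σ̃_ij| ≥ ϖ_ij) for i ≠ j and σ̂_ii = σ̃_ii ∨ 0, where each thresholding function s_ij satisfies |s_ij(x) − x| ≤ ϖ_ij. Then ‖Σ̂ − Σ‖₂ ≤ C · s_p · ϖ^{1−δ}. (This is the deterministic core of the bound ‖Γ̂^s − Γ^s‖₂ = O_p(π(p) ϖ_m^{1−δ}) in Theorem 3.) -/
open Matrix

/-- Schur test: a matrix whose absolute row and column sums are at most `M` has spectral norm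
at most `M`. -/
theorem specNorm_le_of_sum_abs_le {m n : Type*} [Fintype m] [Fintype n] [DecidableEq n]
    (A : Matrix m n ℝ) {M : ℝ} (hM : 0 ≤ M) (hrow : ∀ i, ∑ j, |A i j| ≤ M)
    (hcol : ∀ j, ∑ i, |A i j| ≤ M) : specNorm A ≤ M := by
  refine ContinuousLinearMap.opNorm_le_bound _ hM fun x => ?_
  refine le_of_sq_le_sq ?_ (by positivity)
  rw [mul_pow, EuclideanSpace.norm_sq_eq, EuclideanSpace.norm_sq_eq]
  have happ : ∀ i, (LinearMap.toContinuousLinearMap (Matrix.toEuclideanLin A) x) i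
      = ∑ j, A i j * x j := fun i => rfl
  simp only [happ, Real.norm_eq_abs, sq_abs]
  have hcs : ∀ i, (∑ j, A i j * x j) ^ 2 ≤ M * ∑ j, |A i j| * x j ^ 2 := fun i =>
    (Finset.sum_sq_le_sum_mul_sum_of_sq_le_mul Finset.univ (fun j _ => abs_nonneg (A i j))
      (fun j _ => by positivity) (fun j _ => by rw [mul_pow, ← sq_abs (A i j)]; exact le_of_eq (by ring))).trans
    (mul_le_mul_of_nonneg_right (hrow i) (Finset.sum_nonneg fun j _ => by positivity))
  calc ∑ i, (∑ j, A i j * x j) ^ 2 ≤ ∑ i, M * ∑ j, |A i j| * x j ^ 2 :=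
        Finset.sum_le_sum fun i _ => hcs i
    _ = M * ∑ j, (∑ i, |A i j|) * x j ^ 2 := by
        rw [← Finset.mul_sum, Finset.sum_comm]
        simp only [Finset.sum_mul]
    _ ≤ M * ∑ j, M * x j ^ 2 := by
        gcongr with j
        exact hcol j
    _ = M ^ 2 * ∑ j, x j ^ 2 := by rw [← Finset.mul_sum]; ring

theorem le_mul_rpow_mul_rpow_of_le_mul {δ x t k : ℝ} (hδ0 : 0 ≤ δ) (hδ1 : δ ≤ 1) (hx : 0 ≤ x)
    (ht : 0 ≤ t) (hk : 1 ≤ k) (hxt : x ≤ k * t) : x ≤ k * (t ^ δ * x ^ (1 - δ)) := by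
  calc x = x ^ δ * x ^ (1 - δ) := by
        rw [← Real.rpow_add_of_nonneg hx hδ0 (by linarith)]; simp
    _ ≤ (k * t) ^ δ * x ^ (1 - δ) := by gcongr
    _ = k ^ δ * (t ^ δ * x ^ (1 - δ)) := by rw [Real.mul_rpow (by linarith) ht]; ring
    _ ≤ k * (t ^ δ * x ^ (1 - δ)) := by
        gcongr
        simpa using Real.rpow_le_rpow_of_exponent_le hk hδ1

/-- Hard-thresholding-type error bound for one entry: `s` is the true entry, `y` its estimate,
`z` the shrunken value of `y`, `τ` the threshold and `x` the scale of the threshold. -/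
theorem abs_threshold_sub_le {δ s y z τ a x : ℝ} (hδ0 : 0 ≤ δ) (hδ1 : δ ≤ 1) (hx : 0 ≤ x)
    (hy : |y - s| ≤ a) (ha : a ≤ x / 4) (hτl : x / 2 ≤ τ) (hτu : τ ≤ 3 / 2 * x)
    (hz : |z - y| ≤ τ) :
    |(if τ ≤ |y| then z else 0) - s| ≤ 8 * (|s| ^ δ * x ^ (1 - δ)) := by
  have hsy : |y| - |s| ≤ |y - s| := abs_sub_abs_le_abs_sub y s
  have hys : |s| - |y| ≤ |y - s| := by
    rw [abs_sub_comm]; exact abs_sub_abs_le_abs_sub s y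
  split_ifs with h
  · have hzs : |z - s| ≤ |z - y| + |y - s| := abs_sub_le z y s
    have := le_mul_rpow_mul_rpow_of_le_mul (k := 4) hδ0 hδ1 hx (abs_nonneg s) (by norm_num)
      (by linarith)
    linarith
  · push Not at h
    have hs2 : |s| ≤ 2 * x := by linarith
    rw [zero_sub, abs_neg]
    calc |s| = |s| ^ δ * |s| ^ (1 - δ) := by
          rw [← Real.rpow_add_of_nonneg (abs_nonneg s) hδ0 (by linarith)]; simp
      _ ≤ |s| ^ δ * (2 * x) ^ (1 - δ) := by
          have : 0 ≤ 1 - δ := by linarith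
          gcongr
      _ = 2 ^ (1 - δ) * (|s| ^ δ * x ^ (1 - δ)) := by
          rw [Real.mul_rpow (by norm_num) hx]; ring
      _ ≤ 8 * (|s| ^ δ * x ^ (1 - δ)) := by
          gcongr
          calc (2 : ℝ) ^ (1 - δ) ≤ 2 ^ (1 : ℝ) :=
                Real.rpow_le_rpow_of_exponent_le (by norm_num) (by linarith)
            _ ≤ 8 := by norm_num

/-- Adaptive thresholding, spectral norm bound: there is a constant C depending only
on δ, c₁, c₂ such that for any symmetric Σ with diagonal in [c₁, c₂] satisfying the
generalized sparsity condition at level s_p, any symmetric Σ̃ with entrywise error at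
most a ≤ c₁/2, and any threshold ϖ with 4a/c₁ ≤ ϖ ≤ 1, the adaptively thresholded
matrix Σ̂ satisfies ‖Σ̂ − Σ‖₂ ≤ C·s_p·ϖ^{1−δ}. -/
theorem stmt_13 (δ : ℝ) (hδ0 : 0 ≤ δ) (hδ1 : δ < 1)
    (c₁ c₂ : ℝ) (hc₁ : 0 < c₁) (hc₁₂ : c₁ ≤ c₂) :
    ∃ C : ℝ, 0 < C ∧
      ∀ (p : ℕ), 0 < p →
      ∀ (S St Sh : Matrix (Fin p) (Fin p) ℝ) (sp a ϖ : ℝ)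
        (sfun : Fin p → Fin p → ℝ → ℝ),
        S.IsHermitian →
        (∀ i, c₁ ≤ S i i) → (∀ i, S i i ≤ c₂) →
        0 < sp →
        (∀ j, ∑ i, |S i j| ^ δ * (S i i * S j j) ^ ((1 - δ) / 2) ≤ sp) →
        St.IsHermitian →
        (∀ i j, |St i j - S i j| ≤ a) → a ≤ c₁ / 2 →
        4 * a / c₁ ≤ ϖ → ϖ ≤ 1 →
        (∀ i j x, |sfun i j x - x| ≤ ϖ * Real.sqrt (max (St i i) 0 * max (St j j) 0)) →
        (∀ i j, i ≠ j → Sh i j =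
          if ϖ * Real.sqrt (max (St i i) 0 * max (St j j) 0) ≤ |St i j|
          then sfun i j (St i j) else 0) →
        (∀ i, Sh i i = max (St i i) 0) →
        specNorm (Sh - S) ≤ C * sp * ϖ ^ (1 - δ) := by
  refine ⟨8, by norm_num, ?_⟩
  intro p _ S St Sh sp a ϖ sfun hS hSl _ hsp hsparse _ herr ha hϖl hϖ1 hsfun hoff hdiag
  have ha0 : 0 ≤ a := by
    have i : Fin p := ⟨0, ‹_›⟩
    exact (abs_nonneg _).trans (herr i i)
  have hϖ0 : 0 ≤ ϖ := le_trans (by positivity) hϖl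
  have haϖ : 4 * a ≤ ϖ * c₁ := (div_le_iff₀ hc₁).1 hϖl
  have hpos : ∀ i, 0 < S i i := fun i => hc₁.trans_le (hSl i)
  have hsymm : ∀ i j, S i j = S j i := fun i j => by simpa using hS.apply j i
  have hmaxl : ∀ i, S i i / 2 ≤ max (St i i) 0 := fun i =>
    le_max_of_le_left (by linarith [(abs_le.1 (herr i i)).1, hSl i])
  have hmaxu : ∀ i, max (St i i) 0 ≤ 3 / 2 * S i i := fun i =>
    max_le (by linarith [(abs_le.1 (herr i i)).2, hSl i]) (by linarith [hpos i])
  have hentry : ∀ i j, |(Sh - S) i j| ≤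
      8 * ϖ ^ (1 - δ) * (|S i j| ^ δ * (S i i * S j j) ^ ((1 - δ) / 2)) := by
    intro i j
    have hi := hpos i
    have hj := hpos j
    set w := √(S i i * S j j) with hw
    have hw0 : 0 ≤ w := Real.sqrt_nonneg _
    have hwc : c₁ ≤ w := Real.le_sqrt_of_sq_le (by nlinarith [hSl i, hSl j])
    have hscale : (ϖ * w) ^ (1 - δ) = ϖ ^ (1 - δ) * (S i i * S j j) ^ ((1 - δ) / 2) := by
      rw [Real.mul_rpow hϖ0 hw0, hw, Real.sqrt_eq_rpow, ← Real.rpow_mul (by positivity)]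
      ring_nf
    have hax : a ≤ ϖ * w / 4 := by nlinarith
    suffices h : |(Sh - S) i j| ≤ 8 * (|S i j| ^ δ * (ϖ * w) ^ (1 - δ)) by
      rw [hscale] at h
      linarith
    rw [Matrix.sub_apply]
    by_cases hij : i = j
    · subst hij
      have hwi : w = S i i := by rw [hw, Real.sqrt_mul_self hi.le]
      rw [hdiag, hwi, abs_of_pos hi]
      have h1 : |max (St i i) 0 - S i i| ≤ a := by
        rw [max_eq_left (by linarith [(abs_le.1 (herr i i)).1, hSl i])]
        exact herr i i
      have h2 := le_mul_rpow_mul_rpow_of_le_mul (k := 1) hδ0 hδ1.le (by positivity : 0 ≤ ϖ * S i i)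
        hi.le le_rfl (by nlinarith)
      rw [hwi] at hax
      have : 0 ≤ ϖ * S i i := by positivity
      linarith
    · rw [hoff i j hij]
      have hlow : w / 2 ≤ √(max (St i i) 0 * max (St j j) 0) := by
        refine Real.le_sqrt_of_sq_le ?_
        calc (w / 2) ^ 2 = (S i i / 2) * (S j j / 2) := by
              rw [div_pow, hw, Real.sq_sqrt (by positivity)]; ring
          _ ≤ _ := mul_le_mul (hmaxl i) (hmaxl j) (by positivity) (le_max_right _ _)
      have hup : √(max (St i i) 0 * max (St j j) 0) ≤ 3 / 2 * w := by
        refine Real.sqrt_le_iff.2 ⟨by positivity, ?_⟩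
        calc _ ≤ (3 / 2 * S i i) * (3 / 2 * S j j) :=
              mul_le_mul (hmaxu i) (hmaxu j) (le_max_right _ _) (by positivity)
          _ = (3 / 2 * w) ^ 2 := by
              rw [mul_pow, hw, Real.sq_sqrt (by positivity)]; ring
      exact abs_threshold_sub_le hδ0 hδ1.le (by positivity) (herr i j) hax
        (by nlinarith) (by nlinarith) (hsfun i j _)
  have hcol : ∀ j, ∑ i, |(Sh - S) i j| ≤ 8 * sp * ϖ ^ (1 - δ) := fun j => by
    calc _ ≤ ∑ i, 8 * ϖ ^ (1 - δ) * (|S i j| ^ δ * (S i i * S j j) ^ ((1 - δ) / 2)) :=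
          Finset.sum_le_sum fun i _ => hentry i j
      _ ≤ 8 * ϖ ^ (1 - δ) * sp := by
          rw [← Finset.mul_sum]
          exact mul_le_mul_of_nonneg_left (hsparse j) (by positivity)
      _ = _ := by ring
  have hrow : ∀ i, ∑ j, |(Sh - S) i j| ≤ 8 * sp * ϖ ^ (1 - δ) := fun i => by
    calc _ ≤ ∑ j, 8 * ϖ ^ (1 - δ) * (|S j i| ^ δ * (S j j * S i i) ^ ((1 - δ) / 2)) :=
          Finset.sum_le_sum fun j _ => by
            simpa only [hsymm j i, mul_comm (S j j)] using hentry i j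
      _ ≤ 8 * ϖ ^ (1 - δ) * sp := by
          rw [← Finset.mul_sum]
          exact mul_le_mul_of_nonneg_left (hsparse i) (by positivity)
      _ = _ := by ring
  exact specNorm_le_of_sum_abs_le _ (by positivity) hrow hcol
end

section
/- (Adaptive thresholding: max norm bound.) Fix δ ∈ [0,1) and constants 0 < c₁ ≤ c₂. There exists a constant C, depending only on δ, c₁, c₂, with the following property. Let Σ = (σ_ij) be a p×p real symmetric matrix with c₁ ≤ σ_ii ≤ c₂ for all i, satisfying the generalized sparsity condition max_{1≤j≤p} Σ_{i=1}^p |σ_ij|^δ (σ_ii σ_jj)^{(1−δ)/2} ≤ s_p for some s_p > 0. Let Σ̃ = (σ̃_ij) be a p×p real symmetric matrix with max_{i,j} |σ̃_ij − σ_ij| ≤ a, where a ≤ c₁/2. Let ϖ be a threshold level with 4a/c₁ ≤ ϖ ≤ 1, set adaptive thresholds ϖ_ij = ϖ · sqrt((σ̃_ii ∨ 0)(σ̃_jj ∨ 0)), and define the thresholded matrix Σ̂ = (σ̂_ij) by σ̂_ij = s_ij(σ̃_ij)·1(|σ̃_ij| ≥ ϖ_ij) for i ≠ j and σ̂_ii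 = σ̃_ii ∨ 0, where each thresholding function s_ij satisfies |s_ij(x) − x| ≤ ϖ_ij. Then max_{i,j} |σ̂_ij − σ_ij| ≤ C · ϖ. (This is the deterministic core of the bound ‖Γ̂^s − Γ^s‖_max = O_p(ϖ_m) in Theorem 3.) -/
open Matrix

/-- Adaptive thresholding, max norm bound: there is a constant C depending only
on δ, c₁, c₂ such that for any symmetric Σ with diagonal in [c₁, c₂] satisfying the
generalized sparsity condition at level s_p, any symmetric Σ̃ with entrywise error at
most a ≤ c₁/2, and any threshold ϖ with 4a/c₁ ≤ ϖ ≤ 1, the adaptively thresholded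
matrix Σ̂ satisfies max_{i,j} |σ̂_ij − σ_ij| ≤ C·ϖ. -/
theorem stmt_14 (δ : ℝ) (hδ0 : 0 ≤ δ) (hδ1 : δ < 1)
    (c₁ c₂ : ℝ) (hc₁ : 0 < c₁) (hc₁₂ : c₁ ≤ c₂) :
    ∃ C : ℝ, 0 < C ∧
      ∀ (p : ℕ), 0 < p →
      ∀ (S St Sh : Matrix (Fin p) (Fin p) ℝ) (sp a ϖ : ℝ)
        (sfun : Fin p → Fin p → ℝ → ℝ),
        S.IsHermitian →
        (∀ i, c₁ ≤ S i i) → (∀ i, S i i ≤ c₂) →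
        0 < sp →
        (∀ j, ∑ i, |S i j| ^ δ * (S i i * S j j) ^ ((1 - δ) / 2) ≤ sp) →
        St.IsHermitian →
        (∀ i j, |St i j - S i j| ≤ a) → a ≤ c₁ / 2 →
        4 * a / c₁ ≤ ϖ → ϖ ≤ 1 →
        (∀ i j x, |sfun i j x - x| ≤ ϖ * Real.sqrt (max (St i i) 0 * max (St j j) 0)) →
        (∀ i j, i ≠ j → Sh i j =
          if ϖ * Real.sqrt (max (St i i) 0 * max (St j j) 0) ≤ |St i j|
          then sfun i j (St i j) else 0) →
        (∀ i, Sh i i = max (St i i) 0) →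
        ∀ i j, |Sh i j - S i j| ≤ C * ϖ := by
  refine ⟨3 * c₂, by linarith, ?_⟩
  intro p _ S St Sh sp a ϖ sfun _ hS₁ hS₂ _ _ _ hSt ha hϖ _ hs hoff hdiag i j
  have ha0 : 0 ≤ a := (abs_nonneg _).trans (hSt i i)
  have haϖ : 4 * a ≤ ϖ * c₁ := (div_le_iff₀ hc₁).1 hϖ
  have hϖ0 : 0 ≤ ϖ := le_trans (by positivity) hϖ
  have hcϖ : ϖ * c₁ ≤ ϖ * c₂ := mul_le_mul_of_nonneg_left hc₁₂ hϖ0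
  have hmax : ∀ k, max (St k k) 0 ≤ 2 * c₂ := fun k => by
    have h := abs_le.1 (hSt k k)
    exact max_le (by linarith [hS₂ k]) (by linarith)
  have hsqrt : Real.sqrt (max (St i i) 0 * max (St j j) 0) ≤ 2 * c₂ := by
    refine Real.sqrt_le_iff.2 ⟨by linarith, ?_⟩
    rw [sq]
    exact mul_le_mul (hmax i) (hmax j) (le_max_right _ _) (by linarith)
  have hT := mul_le_mul_of_nonneg_left hsqrt hϖ0
  have hij := abs_le.1 (hSt i j)
  by_cases h : i = j
  · subst h
    rw [hdiag i, abs_le]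
    have hpos := hS₁ i
    rw [max_eq_left (by linarith)]
    constructor <;> linarith
  · rw [hoff i j h]
    split_ifs with hle
    · have h_near := abs_le.1 (hs i j (St i j))
      rw [abs_le]
      constructor <;> linarith
    · have h_small := abs_lt.1 (not_le.1 hle)
      rw [abs_le]
      constructor <;> linarith
end
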